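/- arXiv:2208.00556 — 5 statements merged into one kernel-verified Lean document; each statement's English description precedes it below -/
import Mathlib

section
/- Let g ≥ 2 be an even integer. The quotient of the polynomial ring ℤ[l₁,l₂] by the ideal generated by 6g·l₁ + 2g·l₂ and (g−1)·l₁ − (g+1)·l₂ is isomorphic, as a commutative ring, to ℤ[x]/(4g(2g+1)·x), the quotient of the univariate polynomial ring ℤ[x] by the principal ideal generated by 4g(2g+1)·x. -/
open MvPolynomial

/-- For even `g ≥ 2`, `ℤ[l₁,l₂]/(6gl₁+2gl₂, (g−1)l₁−(g+1)l₂)` is isomorphic as a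
commutative ring to `ℤ[x]/(4g(2g+1)x)`. -/
theorem stmt_5 (g : ℕ) (hg : 2 ≤ g) (hge : Even g) :
    Nonempty
      ((MvPolynomial (Fin 2) ℤ ⧸
          Ideal.span {C (6 * (g : ℤ)) * X 0 + C (2 * (g : ℤ)) * X 1,
            C ((g : ℤ) - 1) * X 0 - C ((g : ℤ) + 1) * X 1})
        ≃+*
      (Polynomial ℤ ⧸
          Ideal.span {Polynomial.C (4 * (g : ℤ) * (2 * (g : ℤ) + 1)) * Polynomial.X})) := by
  obtain ⟨k, hk⟩ := hge
  have hgk : (g : ℤ) = 2 * k := by rw [hk]; push_cast; ring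
  clear hk hg
  generalize (g : ℤ) = m at hgk
  generalize (k : ℤ) = n at hgk
  subst hgk
  set I : Ideal (MvPolynomial (Fin 2) ℤ) :=
    Ideal.span {C (6 * (2 * n)) * X 0 + C (2 * (2 * n)) * X 1,
      C (2 * n - 1) * X 0 - C (2 * n + 1) * X 1} with hI
  set J : Ideal (Polynomial ℤ) :=
    Ideal.span {Polynomial.C (4 * (2 * n) * (2 * (2 * n) + 1)) * Polynomial.X} with hJ
  have h₁ : Ideal.Quotient.mk I (C (6 * (2 * n)) * X 0 + C (2 * (2 * n)) * X 1) = 0 :=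
    Ideal.Quotient.eq_zero_iff_mem.2 (Ideal.subset_span (by simp))
  have h₂ : Ideal.Quotient.mk I (C (2 * n - 1) * X 0 - C (2 * n + 1) * X 1) = 0 :=
    Ideal.Quotient.eq_zero_iff_mem.2 (Ideal.subset_span (by simp))
  have h₃ : Ideal.Quotient.mk J
      (Polynomial.C (4 * (2 * n) * (2 * (2 * n) + 1)) * Polynomial.X) = 0 :=
    Ideal.Quotient.eq_zero_iff_mem.2 (Ideal.subset_span (by simp))
  simp only [map_add, map_sub, map_mul, map_one, map_ofNat, eq_intCast, map_intCast]
    at h₁ h₂ h₃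
  obtain ⟨φ, hφ₀, hφ₁⟩ : ∃ φ : MvPolynomial (Fin 2) ℤ →+* Polynomial ℤ ⧸ J,
      φ (X 0) = (2 * n + 1) * Ideal.Quotient.mk J Polynomial.X ∧
      φ (X 1) = (2 * n - 1) * Ideal.Quotient.mk J Polynomial.X :=
    ⟨eval₂Hom (Int.castRingHom _) ![(2 * n + 1) * Ideal.Quotient.mk J Polynomial.X,
      (2 * n - 1) * Ideal.Quotient.mk J Polynomial.X], by simp, by simp⟩
  obtain ⟨ψ, hψX⟩ : ∃ ψ : Polynomial ℤ →+* MvPolynomial (Fin 2) ℤ ⧸ I,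
      ψ Polynomial.X =
        (1 - n) * Ideal.Quotient.mk I (X 0) + n * Ideal.Quotient.mk I (X 1) :=
    ⟨Polynomial.eval₂RingHom (Int.castRingHom _)
      ((1 - n) * Ideal.Quotient.mk I (X 0) + n * Ideal.Quotient.mk I (X 1)), by simp⟩
  have hφ : ∀ a ∈ I, φ a = 0 := by
    change I ≤ RingHom.ker φ
    rw [hI, Ideal.span_le]
    rintro a (rfl | rfl)
    all_goals
      simp only [SetLike.mem_coe, RingHom.mem_ker, map_add, map_sub, map_mul, map_one, map_ofNat,
        eq_intCast, map_intCast, hφ₀, hφ₁]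
    · linear_combination h₃
    · ring
  have hψ : ∀ a ∈ J, ψ a = 0 := by
    change J ≤ RingHom.ker ψ
    rw [hJ, Ideal.span_le]
    rintro a rfl
    simp only [SetLike.mem_coe, RingHom.mem_ker, map_add, map_mul, map_one, map_ofNat,
      eq_intCast, map_intCast, hψX]
    linear_combination h₁ - (16 * n ^ 2 - 4 * n) * h₂
  refine ⟨RingEquiv.ofRingHom (Ideal.Quotient.lift I φ hφ) (Ideal.Quotient.lift J ψ hψ) ?_ ?_⟩
  · ext
    · simp
    · simp only [RingHom.comp_apply, RingHom.id_apply, Ideal.Quotient.lift_mk, hψX, map_add,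
        map_sub, map_mul, map_one, map_intCast, hφ₀, hφ₁]
      ring
  · ext i
    · simp
    · fin_cases i
      all_goals
        simp only [Fin.zero_eta, Fin.mk_one, RingHom.comp_apply, RingHom.id_apply,
          Ideal.Quotient.lift_mk, hφ₀, hφ₁, map_add, map_sub, map_mul, map_one, map_ofNat,
          map_intCast, hψX]
      · linear_combination -(n : MvPolynomial (Fin 2) ℤ ⧸ I) * h₂
      · linear_combination -((n : MvPolynomial (Fin 2) ℤ ⧸ I) - 1) * h₂
end

section
/- Let g ≥ 3 be an odd integer. The quotient of the polynomial ring ℤ[l₁,l₂] by the ideal generated by 8g·l₁ + 2g·l₂ and −2·l₁ + g·l₂ is isomorphic, as a commutative ring, to ℤ[x]/(4g(2g+1)·x), the quotient of the univariate polynomial ring ℤ[x] by the principal ideal generated by 4g(2g+1)·x. -/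
open MvPolynomial

/-- For odd `g ≥ 3`, `ℤ[l₁,l₂]/(8gl₁+2gl₂, −2l₁+gl₂)` is isomorphic as a
commutative ring to `ℤ[x]/(4g(2g+1)x)`. -/
theorem stmt_10 (g : ℕ) (hg : 3 ≤ g) (hgo : Odd g) :
    Nonempty
      ((MvPolynomial (Fin 2) ℤ ⧸
          Ideal.span {C (8 * (g : ℤ)) * X 0 + C (2 * (g : ℤ)) * X 1,
            C (-2 : ℤ) * X 0 + C (g : ℤ) * X 1})
        ≃+*
      (Polynomial ℤ ⧸
          Ideal.span {Polynomial.C (4 * (g : ℤ) * (2 * (g : ℤ) + 1)) * Polynomial.X})) := by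
  obtain ⟨k, rfl⟩ := hgo
  generalize hI : Ideal.span {C (8 * ((2 * k + 1 : ℕ) : ℤ)) * X 0 +
    C (2 * ((2 * k + 1 : ℕ) : ℤ)) * X 1,
    C (-2 : ℤ) * X 0 + C ((2 * k + 1 : ℕ) : ℤ) * (X 1 : MvPolynomial (Fin 2) ℤ)} = I
  generalize hJ : Ideal.span {Polynomial.C (4 * ((2 * k + 1 : ℕ) : ℤ) *
    (2 * ((2 * k + 1 : ℕ) : ℤ) + 1)) * (Polynomial.X : Polynomial ℤ)} = J
  have h₁ : C (8 * ((2 * k + 1 : ℕ) : ℤ)) * X 0 + C (2 * ((2 * k + 1 : ℕ) : ℤ)) * X 1 ∈ I :=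
    hI ▸ Ideal.subset_span (by simp)
  have h₂ : C (-2 : ℤ) * X 0 + C ((2 * k + 1 : ℕ) : ℤ) * X 1 ∈ I :=
    hI ▸ Ideal.subset_span (by simp)
  have h₃ : Polynomial.C (4 * ((2 * k + 1 : ℕ) : ℤ) * (2 * ((2 * k + 1 : ℕ) : ℤ) + 1)) *
      Polynomial.X ∈ J := hJ ▸ Ideal.subset_span (by simp)
  rw [← Ideal.Quotient.eq_zero_iff_mem] at h₁ h₂ h₃
  simp only [map_add, map_mul, map_natCast, map_ofNat, map_neg, map_one, Nat.cast_add,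
    Nat.cast_mul, Nat.cast_ofNat, Nat.cast_one] at h₁ h₂ h₃
  -- The second relation makes `l₁ = g t` and `l₂ = 2 t` for `t = l₁ - k l₂`.
  obtain ⟨φ, hφ₀, hφ₁⟩ : ∃ φ : MvPolynomial (Fin 2) ℤ →+* Polynomial ℤ ⧸ J,
      φ (X 0) = (2 * k + 1) * Ideal.Quotient.mk J Polynomial.X ∧
      φ (X 1) = 2 * Ideal.Quotient.mk J Polynomial.X :=
    ⟨eval₂Hom (Int.castRingHom _) ![(2 * k + 1) * Ideal.Quotient.mk J Polynomial.X,
      2 * Ideal.Quotient.mk J Polynomial.X], by simp, by simp⟩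
  obtain ⟨ψ, hψX⟩ : ∃ ψ : Polynomial ℤ →+* MvPolynomial (Fin 2) ℤ ⧸ I,
      ψ Polynomial.X = Ideal.Quotient.mk I (X 0) - k * Ideal.Quotient.mk I (X 1) :=
    ⟨Polynomial.eval₂RingHom (Int.castRingHom _)
      (Ideal.Quotient.mk I (X 0) - k * Ideal.Quotient.mk I (X 1)), by simp⟩
  have hφ : ∀ p ∈ I, φ p = 0 := by
    change I ≤ RingHom.ker φ
    rw [← hI, Ideal.span_le]
    rintro p (rfl | rfl)
    · simp only [SetLike.mem_coe, RingHom.mem_ker, map_add, map_mul, map_natCast,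
        map_ofNat, map_one, Nat.cast_add, Nat.cast_mul, Nat.cast_ofNat, Nat.cast_one,
        hφ₀, hφ₁]
      linear_combination h₃
    · simp only [SetLike.mem_coe, RingHom.mem_ker, map_add, map_mul, map_natCast,
        map_ofNat, map_neg, map_one, Nat.cast_add, Nat.cast_mul, Nat.cast_ofNat, Nat.cast_one,
        hφ₀, hφ₁]
      ring
  have hψ : ∀ p ∈ J, ψ p = 0 := by
    change J ≤ RingHom.ker ψ
    rw [← hJ, Ideal.span_le]
    rintro p rfl
    simp only [SetLike.mem_coe, RingHom.mem_ker, map_add, map_mul, map_natCast,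
        map_ofNat, map_one, Nat.cast_add, Nat.cast_mul, Nat.cast_ofNat, Nat.cast_one,
        hψX]
    linear_combination h₁ - (8 * (2 * k + 1) * k + 2 * (2 * k + 1)) * h₂
  have lift_φ (p) : Ideal.Quotient.lift I φ hφ (Ideal.Quotient.mk I p) = φ p := rfl
  have lift_ψ (p) : Ideal.Quotient.lift J ψ hψ (Ideal.Quotient.mk J p) = ψ p := rfl
  refine ⟨RingEquiv.ofRingHom (Ideal.Quotient.lift I φ hφ) (Ideal.Quotient.lift J ψ hψ) ?_ ?_⟩
  · refine Ideal.Quotient.ringHom_ext (Polynomial.ringHom_ext (by simp) ?_)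
    simp only [RingHom.comp_apply, RingHom.id_apply, lift_ψ, hψX, map_sub, map_mul, map_natCast,
      lift_φ, hφ₀, hφ₁]
    ring
  · refine Ideal.Quotient.ringHom_ext (MvPolynomial.ringHom_ext (by simp) fun i ↦ ?_)
    fin_cases i
    · simp only [Fin.zero_eta, RingHom.comp_apply, RingHom.id_apply, lift_φ, hφ₀, map_add,
        map_mul, map_natCast, map_ofNat, map_one, lift_ψ, hψX]
      linear_combination -k * h₂
    · simp only [Fin.mk_one, RingHom.comp_apply, RingHom.id_apply, lift_φ, hφ₁, map_mul,
        map_ofNat, lift_ψ, hψX]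
      linear_combination -h₂
end

section
/- Let g ≥ 2 be an even integer. The quotient of the polynomial ring ℤ[l₁,l₂] by the ideal generated by (g−1)·l₁ − (g+1)·l₂ and 2·(l₁ + l₂) is isomorphic, as a commutative ring, to ℤ[x]/(4g·x), the quotient of the univariate polynomial ring ℤ[x] by the principal ideal generated by 4g·x. -/
open MvPolynomial

/-- For even `g ≥ 2`, `ℤ[l₁,l₂]/((g−1)l₁−(g+1)l₂, 2(l₁+l₂))` is isomorphic as a
commutative ring to `ℤ[x]/(4gx)`. -/
theorem stmt_12 (g : ℕ) (hg : 2 ≤ g) (hge : Even g) :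
    Nonempty
      ((MvPolynomial (Fin 2) ℤ ⧸
          Ideal.span {C ((g : ℤ) - 1) * X 0 - C ((g : ℤ) + 1) * X 1,
            C (2 : ℤ) * (X 0 + X 1)})
        ≃+*
      (Polynomial ℤ ⧸ Ideal.span {Polynomial.C (4 * (g : ℤ)) * Polynomial.X})) := by
  obtain ⟨k, rfl⟩ := hge
  set I : Ideal (MvPolynomial (Fin 2) ℤ) :=
    Ideal.span {C (((k + k : ℕ) : ℤ) - 1) * X 0 - C (((k + k : ℕ) : ℤ) + 1) * X 1,
      C (2 : ℤ) * (X 0 + X 1)} with hI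
  set J : Ideal (Polynomial ℤ) :=
    Ideal.span {Polynomial.C (4 * ((k + k : ℕ) : ℤ)) * Polynomial.X} with hJ
  let φ : MvPolynomial (Fin 2) ℤ →ₐ[ℤ] Polynomial ℤ :=
    aeval ![Polynomial.X, Polynomial.C (4 * (k : ℤ) - 1) * Polynomial.X]
  let ψ : Polynomial ℤ →ₐ[ℤ] MvPolynomial (Fin 2) ℤ := Polynomial.aeval (X 0)
  have hφ : I ≤ J.comap φ := by
    rw [hI, Ideal.span_le]
    rintro p (rfl | rfl) <;>
      simp only [SetLike.mem_coe, Ideal.mem_comap, hJ, Ideal.mem_span_singleton']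
    · exact ⟨-(k : Polynomial ℤ), by simp [φ]; ring⟩
    · exact ⟨1, by simp [φ]; ring⟩
  have hψ : J ≤ I.comap ψ := by
    rw [hJ, Ideal.span_le, Set.singleton_subset_iff, SetLike.mem_coe, Ideal.mem_comap, hI,
      Ideal.mem_span_pair]
    exact ⟨2, 2 * (k : MvPolynomial (Fin 2) ℤ) + 1, by simp [ψ, map_ofNat]; ring⟩
  have hX : C (4 * (k : ℤ) - 1) * X 0 - X 1 ∈ I := by
    rw [hI, Ideal.mem_span_pair]
    exact ⟨1, (k : MvPolynomial (Fin 2) ℤ), by simp; ring⟩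
  refine ⟨(AlgEquiv.ofAlgHom (Ideal.quotientMapₐ J φ hφ) (Ideal.quotientMapₐ I ψ hψ)
    ?_ ?_).toRingEquiv⟩
  · apply Ideal.Quotient.algHom_ext
    ext
    simp [φ, ψ]
  · apply Ideal.Quotient.algHom_ext
    ext i
    fin_cases i
    · simp [φ, ψ]
    · simpa [φ, ψ, map_ofNat] using Ideal.Quotient.eq.mpr hX
end

section
/- Let g ≥ 3 be an odd integer. In the polynomial ring ℤ[τ,c₂,c₃], the polynomial p = (g+1)²·τ^g·(τ² + c₂)^{(g+1)/2}·c₂ + τ^{(g+3)/2}·(τ³ + τc₂ − c₃)^{(g+1)/2} does NOT belong to the ideal generated by 2τ² − 2g(g+1)c₂, 2(2g+1)τ, and 2c₃. -/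
open MvPolynomial

/-- For odd `g ≥ 3`, in `ℤ[τ,c₂,c₃]` (with `τ = X 0`, `c₂ = X 1`, `c₃ = X 2`),
the polynomial
`p = (g+1)²τ^g(τ²+c₂)^{(g+1)/2}c₂ + τ^{(g+3)/2}(τ³+τc₂−c₃)^{(g+1)/2}`
does not lie in the ideal generated by `2τ² − 2g(g+1)c₂`, `2(2g+1)τ` and `2c₃`. -/
theorem stmt_17 (g : ℕ) (hg : 3 ≤ g) (hgo : Odd g) :
    (C (((g : ℤ) + 1) ^ 2) * X 0 ^ g * (X 0 ^ 2 + X 1) ^ ((g + 1) / 2) * X 1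
        + X 0 ^ ((g + 3) / 2) * (X 0 ^ 3 + X 0 * X 1 - X 2) ^ ((g + 1) / 2)
      : MvPolynomial (Fin 3) ℤ) ∉
      Ideal.span {C (2 : ℤ) * X 0 ^ 2 - C (2 * (g : ℤ) * ((g : ℤ) + 1)) * X 1,
        C (2 * (2 * (g : ℤ) + 1)) * X 0, C (2 : ℤ) * X 2} := by
  intro h
  let f : MvPolynomial (Fin 3) ℤ →+* ZMod 2 := eval₂Hom (Int.castRingHom (ZMod 2)) ![1, 0, 0]
  have two_eq_zero : (2 : ZMod 2) = 0 := rfl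
  have hker := (Ideal.span_le (I := RingHom.ker f)).2 (by
    rintro x (rfl | rfl | rfl) <;> simp [f, RingHom.mem_ker, two_eq_zero]) h
  have succ_eq_zero : (g : ZMod 2) + 1 = 0 := by
    exact_mod_cast (ZMod.natCast_eq_zero_iff_even).2 hgo.add_one
  simp [f, RingHom.mem_ker, succ_eq_zero] at hker
end

section
/- Let g ≥ 2 be an even integer. In the polynomial ring ℤ[τ,c₂,c₃], the polynomial p = g(g+2)·τ^{g+1}·(τ² + c₂)^{g/2}·c₂ + τ^{g/2}·(τ³ + τc₂ − c₃)^{(g+2)/2} does NOT belong to the ideal generated by 2τ² − 2g(g+1)c₂, 2(2g+1)τ, and 2c₃. -/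
open MvPolynomial

/-- For even `g ≥ 2`, in `ℤ[τ,c₂,c₃]` (with `τ = X 0`, `c₂ = X 1`, `c₃ = X 2`),
the polynomial
`p = g(g+2)τ^{g+1}(τ²+c₂)^{g/2}c₂ + τ^{g/2}(τ³+τc₂−c₃)^{(g+2)/2}`
does not lie in the ideal generated by `2τ² − 2g(g+1)c₂`, `2(2g+1)τ` and `2c₃`. -/
theorem stmt_18 (g : ℕ) (hg : 2 ≤ g) (hge : Even g) :
    (C ((g : ℤ) * ((g : ℤ) + 2)) * X 0 ^ (g + 1) * (X 0 ^ 2 + X 1) ^ (g / 2) * X 1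
        + X 0 ^ (g / 2) * (X 0 ^ 3 + X 0 * X 1 - X 2) ^ ((g + 2) / 2)
      : MvPolynomial (Fin 3) ℤ) ∉
      Ideal.span {C (2 : ℤ) * X 0 ^ 2 - C (2 * (g : ℤ) * ((g : ℤ) + 1)) * X 1,
        C (2 * (2 * (g : ℤ) + 1)) * X 0, C (2 : ℤ) * X 2} := by
  intro h
  -- Every generator is divisible by 2, but `p` is odd at `(τ, c₂, c₃) = (1, 0, 0)`.
  let φ : MvPolynomial (Fin 3) ℤ →+* ZMod 2 :=
    eval₂Hom (Int.castRingHom (ZMod 2)) ![1, 0, 0]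
  have two_eq_zero : (2 : ZMod 2) = 0 := by decide
  have hker : Ideal.span {C (2 : ℤ) * X 0 ^ 2 - C (2 * (g : ℤ) * ((g : ℤ) + 1)) * X 1,
      C (2 * (2 * (g : ℤ) + 1)) * X 0, C (2 : ℤ) * X 2} ≤ RingHom.ker φ := by
    rw [Ideal.span_le]
    rintro x (rfl | rfl | rfl) <;>
      simp [φ, RingHom.mem_ker, two_eq_zero]
  have hp := RingHom.mem_ker.mp (hker h)
  simp [φ] at hp
end
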